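/- arXiv:2502.14648 — 4 statements merged into one kernel-verified Lean document; each statement's English description precedes it below -/
import Mathlib

section
/- Assume f is bounded below with f* = inf f, and run the NFG-SVRG algorithm with stepsize γ satisfying 0 < γ ≤ 1/(20Ln). Then for every number of epochs S ≥ 1, the averaged squared gradient norm satisfies (1/S)∑_{s=1}^{S} ‖∇f(ω_s)‖² ≤ (4/(γnS))·(f(ω_1) − f*). -/
open scoped InnerProductSpace

section Smoothness

variable {E : Type*} [NormedAddCommGroup E] [InnerProductSpace ℝ E] [CompleteSpace E]

/-- A descent inequality for functions with Lipschitz gradient (without the sharp factor `1 / 2`). -/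
theorem le_add_inner_gradient_add_mul_norm_sq {f : E → ℝ} {L : ℝ} (hL : 0 ≤ L)
    (hf : Differentiable ℝ f) (hlip : ∀ x y, ‖gradient f x - gradient f y‖ ≤ L * ‖x - y‖)
    (x y : E) : f y ≤ f x + ⟪gradient f x, y - x⟫_ℝ + L * ‖y - x‖ ^ 2 := by
  have key := (convex_segment x y).norm_image_sub_le_of_norm_hasFDerivWithin_le' (f := f)
    (f' := fun z => InnerProductSpace.toDual ℝ E (gradient f z))
    (φ := InnerProductSpace.toDual ℝ E (gradient f x)) (C := L * ‖y - x‖)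
    (fun z _ => ((hf z).hasGradientAt.hasFDerivAt).hasFDerivWithinAt)
    (fun z hz => by
      rw [← map_sub, LinearIsometryEquiv.norm_map]
      refine (hlip z x).trans (mul_le_mul_of_nonneg_left ?_ hL)
      obtain ⟨t, ht, rfl⟩ := segment_eq_image' ℝ x y ▸ hz
      rw [add_sub_cancel_left, norm_smul, Real.norm_of_nonneg ht.1]
      exact mul_le_of_le_one_left (norm_nonneg _) ht.2)
    (left_mem_segment ℝ x y) (right_mem_segment ℝ x y)
  rw [InnerProductSpace.toDual_apply_apply] at key
  have := (le_abs_self _).trans key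
  linarith

theorem gradient_smul_sum {ι : Type*} [Fintype ι] {F : ι → E → ℝ}
    (hF : ∀ i, Differentiable ℝ (F i)) (c : ℝ) (z : E) :
    gradient (fun y => c * ∑ i, F i y) z = c • ∑ i, gradient (F i) z := by
  refine HasGradientAt.gradient ?_
  rw [hasGradientAt_iff_hasFDerivAt, map_smul, map_sum]
  exact (HasFDerivAt.fun_sum fun i _ => ((hF i) z).hasGradientAt.hasFDerivAt).const_mul c

end Smoothness

theorem norm_average_le {E : Type*} [NormedAddCommGroup E] [NormedSpace ℝ E] {n : ℕ}
    (hn : 1 ≤ n) {u : Fin n → E} {B : ℝ} (hu : ∀ i, ‖u i‖ ≤ B) :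
    ‖(1 / (n : ℝ)) • ∑ i, u i‖ ≤ B := by
  have hn' : (0 : ℝ) < n := by exact_mod_cast hn
  have h : ‖∑ i, u i‖ ≤ n * B := by
    refine (norm_sum_le_of_le _ fun i _ => hu i).trans ?_
    simp
  rw [norm_smul, Real.norm_of_nonneg (by positivity), one_div, inv_mul_le_iff₀ hn']
  exact h

/-- Iterates whose steps grow at most linearly in the distance to the starting point stay close to
one another. -/
theorem mul_norm_sub_le_of_norm_step_le {E : Type*} [NormedAddCommGroup E] {n : ℕ} {L γ V : ℝ}
    (hL : 0 ≤ L) (hγ : 0 ≤ γ) (hV : 0 ≤ V)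
    (ha : L * γ * n ≤ 1 / 20) {x : ℕ → E}
    (hx : ∀ t < n, ‖x (t + 1) - x t‖ ≤ γ * (L * ‖x t - x 0‖ + V))
    {i j : ℕ} (hij : i ≤ j) (hj : j ≤ n) : L * ‖x i - x j‖ ≤ V / 19 := by
  have step : ∀ t < n, ‖x t - x 0‖ ≤ t * (γ * (20 / 19 * V)) →
      ‖x (t + 1) - x t‖ ≤ γ * (20 / 19 * V) := by
    intro t ht h
    refine (hx t ht).trans (mul_le_mul_of_nonneg_left ?_ hγ)
    have htn : (t : ℝ) ≤ n := by exact_mod_cast ht.le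
    have h1 : L * ‖x t - x 0‖ ≤ L * (n * (γ * (20 / 19 * V))) := by gcongr; exact h.trans (by gcongr)
    have h2 := mul_le_mul_of_nonneg_right ha hV
    linarith
  have dist0 : ∀ t ≤ n, ‖x t - x 0‖ ≤ t * (γ * (20 / 19 * V)) := by
    intro t
    induction t with
    | zero => simp
    | succ t ih =>
      intro ht
      have h := ih (by omega)
      have h' := norm_sub_le_norm_sub_add_norm_sub (x (t + 1)) (x t) (x 0)
      have := step t (by omega) h
      push_cast
      linarith
  have h := dist_le_Ico_sum_of_dist_le (f := x) (d := fun _ => γ * (20 / 19 * V)) hij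
    (fun {k} _ hk => by
      rw [dist_comm, dist_eq_norm]
      exact step k (by omega) (dist0 k (by omega)))
  rw [dist_eq_norm, Finset.sum_const, Nat.card_Ico, nsmul_eq_mul] at h
  have hjn : ((j - i : ℕ) : ℝ) ≤ n := by exact_mod_cast (by omega : j - i ≤ n)
  have h1 : L * ‖x i - x j‖ ≤ L * (n * (γ * (20 / 19 * V))) := by gcongr; exact h.trans (by gcongr)
  have h2 := mul_le_mul_of_nonneg_right ha hV
  linarith

/-- One step of inexact gradient descent along a direction `g`. -/
theorem le_sub_of_inexact_gradient_step {E : Type*} [NormedAddCommGroup E] [InnerProductSpace ℝ E]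
    [CompleteSpace E] {f : E → ℝ} {L η : ℝ} (hL : 0 ≤ L) (hη : 0 ≤ η) (hLη : L * η ≤ 1 / 2)
    (hf : Differentiable ℝ f) (hlip : ∀ x y, ‖gradient f x - gradient f y‖ ≤ L * ‖x - y‖)
    (x g : E) :
    f (x - η • g) ≤ f x - η / 2 * ‖gradient f x‖ ^ 2 + η / 2 * ‖gradient f x - g‖ ^ 2 := by
  have h := le_add_inner_gradient_add_mul_norm_sq hL hf hlip x (x - η • g)
  rw [sub_sub_cancel_left, inner_neg_right, inner_smul_right, norm_neg, norm_smul,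
    Real.norm_of_nonneg hη] at h
  have h2 := norm_sub_sq_real (gradient f x) g
  have h3 : L * η * (η * ‖g‖ ^ 2) ≤ 1 / 2 * (η * ‖g‖ ^ 2) := by gcongr
  rw [h2]
  linarith

/-- Telescoping a perturbed descent inequality by means of a Lyapunov function. -/
theorem sum_sq_le_of_perturbed_descent {φ G V e : ℕ → ℝ} {η : ℝ} (hη : 0 ≤ η) (hV0 : V 0 = 0)
    (hV : ∀ s, 0 ≤ V s) (he : ∀ s, 0 ≤ e s)
    (hdesc : ∀ s, φ (s + 2) ≤ φ (s + 1) - η / 2 * G (s + 1) ^ 2 + η / 2 * e (s + 1) ^ 2)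
    (hVG : ∀ s, V (s + 1) ≤ G (s + 1) + V s / 19)
    (heV : ∀ s, e (s + 1) ≤ V s / 19 + V (s + 1) / 19) (S : ℕ) :
    η / 4 * ∑ s ∈ Finset.Icc 1 S, G s ^ 2 ≤ φ 1 - φ (S + 1) := by
  suffices h : η / 4 * ∑ s ∈ Finset.Icc 1 S, G s ^ 2 + η * (V S ^ 2 / 100) ≤ φ 1 - φ (S + 1) by
    have : 0 ≤ η * (V S ^ 2 / 100) := by positivity
    linarith
  induction S with
  | zero => simp [hV0]
  | succ s ih =>
    rw [Finset.sum_Icc_succ_top (by omega)]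
    have h1 : V (s + 1) ^ 2 ≤ 2 * G (s + 1) ^ 2 + 2 / 361 * V s ^ 2 := by
      have := pow_le_pow_left₀ (hV _) (hVG s) 2
      linarith [sq_nonneg (G (s + 1) - V s / 19)]
    have h2 : e (s + 1) ^ 2 ≤ 2 / 361 * V s ^ 2 + 2 / 361 * V (s + 1) ^ 2 := by
      have := pow_le_pow_left₀ (he _) (heV s) 2
      linarith [sq_nonneg (V s / 19 - V (s + 1) / 19)]
    have h3 : G (s + 1) ^ 2 / 4 + V (s + 1) ^ 2 / 100 - V s ^ 2 / 100 - G (s + 1) ^ 2 / 2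
        + e (s + 1) ^ 2 / 2 ≤ 0 := by
      linarith [sq_nonneg (G (s + 1)), sq_nonneg (V s)]
    have h4 := mul_nonpos_of_nonneg_of_nonpos hη h3
    have h5 := hdesc s
    linarith


/-- Theorem 1 (NFG-SVRG, non-convex): if `f` is bounded below with infimum `f*`,
then for the NFG-SVRG algorithm with stepsize `0 < γ ≤ 1/(20 L n)`, the averaged
squared gradient norm over the first `S` epochs satisfies
`(1/S) ∑_{s=1}^S ‖∇f(ω_s)‖² ≤ (4/(γ n S)) (f(ω_1) - f*)`. -/
theorem nfg_svrg_nonconvex {n d : ℕ} (hn : 1 ≤ n) (hd : 1 ≤ d)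
    (L : ℝ) (hL : 0 < L)
    (F : Fin n → EuclideanSpace ℝ (Fin d) → ℝ)
    (hdiff : ∀ i, Differentiable ℝ (F i))
    (hlip : ∀ i x y, ‖gradient (F i) x - gradient (F i) y‖ ≤ L * ‖x - y‖)
    (f : EuclideanSpace ℝ (Fin d) → ℝ)
    (hf : ∀ z, f z = (1 / (n : ℝ)) * ∑ i, F i z)
    (fstar : ℝ) (hfstar : IsGLB (Set.range f) fstar)
    (γ : ℝ) (hγ0 : 0 < γ) (hγ : γ ≤ 1 / (20 * L * n))
    -- the NFG-SVRG algorithm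
    (ω : ℕ → EuclideanSpace ℝ (Fin d)) (v : ℕ → EuclideanSpace ℝ (Fin d))
    (x : ℕ → ℕ → EuclideanSpace ℝ (Fin d)) (vt : ℕ → ℕ → EuclideanSpace ℝ (Fin d))
    (π : ℕ → Equiv.Perm (Fin n))
    (hω0 : ω 0 = x 0 0) (hv0 : v 0 = 0)
    (hx0 : ∀ s, x s 0 = ω s)
    (hvt : ∀ s t (ht : t < n),
      vt s t = gradient (F (π s ⟨t, ht⟩)) (x s t)
        - gradient (F (π s ⟨t, ht⟩)) (ω s) + v s)
    (hxt : ∀ s t, t < n → x s (t + 1) = x s t - γ • vt s t)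
    (hωs : ∀ s, ω (s + 1) = x s n)
    (hxs : ∀ s, x (s + 1) 0 = x s n)
    (hvs : ∀ s, v (s + 1) = (1 / (n : ℝ)) • ∑ t : Fin n, gradient (F (π s t)) (x s t))
    (S : ℕ) (hS : 1 ≤ S) :
    (1 / (S : ℝ)) * ∑ s ∈ Finset.Icc 1 S, ‖gradient f (ω s)‖ ^ 2 ≤
      (4 / (γ * n * S)) * (f (ω 1) - fstar) := by
  have hn' : (0 : ℝ) < n := by exact_mod_cast hn
  have ha : L * γ * n ≤ 1 / 20 := by
    rw [le_div_iff₀ (by positivity)] at hγ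
    linarith
  have hf' : f = fun z => (1 / (n : ℝ)) * ∑ i, F i z := funext hf
  have hgrad : ∀ z, gradient f z = (1 / (n : ℝ)) • ∑ i, gradient (F i) z := by
    intro z
    rw [hf']
    exact gradient_smul_sum hdiff _ z
  have hfdiff : Differentiable ℝ f := by
    rw [hf']
    exact (Differentiable.fun_sum fun i _ => hdiff i).const_mul _
  have hflip : ∀ y z, ‖gradient f y - gradient f z‖ ≤ L * ‖y - z‖ := by
    intro y z
    rw [hgrad, hgrad, ← smul_sub, ← Finset.sum_sub_distrib]
    exact norm_average_le hn fun i => hlip i y z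
  have hvtv : ∀ s t, t < n → ‖vt s t - v s‖ ≤ L * ‖x s t - x s 0‖ := by
    intro s t ht
    rw [hvt s t ht, add_sub_cancel_right, hx0]
    exact hlip _ _ _
  have hstep : ∀ s, ∀ t < n, ‖x s (t + 1) - x s t‖ ≤ γ * (L * ‖x s t - x s 0‖ + ‖v s‖) := by
    intro s t ht
    rw [hxt s t ht, sub_sub_cancel_left, norm_neg, norm_smul, Real.norm_of_nonneg hγ0.le]
    refine mul_le_mul_of_nonneg_left ?_ hγ0.le
    have h1 := hvtv s t ht
    have h2 := norm_le_norm_sub_add (vt s t) (v s)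
    linarith
  have hclose : ∀ s i j, i ≤ j → j ≤ n → L * ‖x s i - x s j‖ ≤ ‖v s‖ / 19 := fun s i j hij hj =>
    mul_norm_sub_le_of_norm_step_le hL.le hγ0.le (norm_nonneg _) ha (hstep s) hij hj
  have hgv : ∀ s, ‖gradient f (ω (s + 1)) - v (s + 1)‖ ≤ ‖v s‖ / 19 := by
    intro s
    rw [hgrad, hvs, ← Equiv.sum_comp (π s), ← smul_sub, ← Finset.sum_sub_distrib]
    refine norm_average_le hn fun t => (hlip _ _ _).trans ?_
    rw [hωs, norm_sub_rev]
    exact hclose s t n t.2.le le_rfl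
  set g : ℕ → EuclideanSpace ℝ (Fin d) := fun s => (1 / (n : ℝ)) • ∑ t : Fin n, vt s t with hg
  have hgv' : ∀ s, ‖v s - g s‖ ≤ ‖v s‖ / 19 := by
    intro s
    have : g s - v s = (1 / (n : ℝ)) • ∑ t : Fin n, (vt s t - v s) := by
      rw [Finset.sum_sub_distrib, smul_sub, Finset.sum_const, Finset.card_univ, Fintype.card_fin,
        ← Nat.cast_smul_eq_nsmul ℝ, smul_smul, one_div_mul_cancel hn'.ne', one_smul]
    rw [norm_sub_rev, this]
    refine norm_average_le hn fun t => (hvtv s t t.2).trans ?_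
    rw [norm_sub_rev]
    exact hclose s 0 t (Nat.zero_le _) t.2.le
  have hωg : ∀ s, ω (s + 1) = ω s - (γ * n) • g s := by
    intro s
    have h : ∀ t ≤ n, x s t = ω s - γ • ∑ k ∈ Finset.range t, vt s k := by
      intro t
      induction t with
      | zero => simp [hx0]
      | succ t ih =>
        intro ht
        rw [hxt s t (by omega), ih (by omega), Finset.sum_range_succ, smul_add, sub_sub]
    rw [hωs, h n le_rfl, Finset.sum_range, hg, smul_smul, mul_assoc, mul_one_div_cancel hn'.ne',
      mul_one]
  have hη : 0 < γ * n := by positivity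
  have key := sum_sq_le_of_perturbed_descent (φ := fun s => f (ω s))
    (G := fun s => ‖gradient f (ω s)‖) (V := fun s => ‖v s‖)
    (e := fun s => ‖gradient f (ω s) - g s‖) hη.le (by simp [hv0])
    (fun _ => norm_nonneg _) (fun _ => norm_nonneg _)
    (fun s => by
      rw [hωg (s + 1)]
      exact le_sub_of_inexact_gradient_step hL.le hη.le (by linarith) hfdiff hflip _ _)
    (fun s => by
      have h1 := norm_le_norm_add_norm_sub (gradient f (ω (s + 1))) (v (s + 1))
      linarith [hgv s])
    (fun s => (norm_sub_le_norm_sub_add_norm_sub _ (v (s + 1)) _).trans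
      (add_le_add (hgv s) (hgv' (s + 1)))) S
  have hlow : fstar ≤ f (ω (S + 1)) := hfstar.1 ⟨_, rfl⟩
  have hS' : (0 : ℝ) < S := by exact_mod_cast hS
  have hsum : ∑ s ∈ Finset.Icc 1 S, ‖gradient f (ω s)‖ ^ 2 ≤
      4 / (γ * n) * (f (ω 1) - fstar) := by
    rw [div_mul_eq_mul_div, le_div_iff₀ hη]
    linarith
  calc (1 / (S : ℝ)) * ∑ s ∈ Finset.Icc 1 S, ‖gradient f (ω s)‖ ^ 2
      ≤ (1 / (S : ℝ)) * (4 / (γ * n) * (f (ω 1) - fstar)) := by gcongr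
    _ = (4 / (γ * n * S)) * (f (ω 1) - fstar) := by field_simp
end

section
/- Assume additionally that each f_i is μ-strongly convex for some 0 < μ ≤ L, that n ≥ 2, and run the NFG-SVRG algorithm with stepsize γ satisfying 0 < γ ≤ 1/(20Ln). Let f* = min f. Then for every S ≥ 1, f(ω_{S+1}) − f* ≤ (1 − γμn/2)^S · (f(ω_1) − f*). -/
open scoped RealInnerProductSpace

section NFGSVRG

variable {E : Type*} [NormedAddCommGroup E] [InnerProductSpace ℝ E]

/-- The average of `n` vectors, each of norm at most `C`, has norm at most `C`. -/
lemma norm_average_le_s6 {n : ℕ} (hn : 0 < n) {C : ℝ} (a : Fin n → E) (ha : ∀ i, ‖a i‖ ≤ C) :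
    ‖(1 / (n : ℝ)) • ∑ i, a i‖ ≤ C := by
  have hn' : (0 : ℝ) < n := by exact_mod_cast hn
  have hsum : ‖∑ i, a i‖ ≤ n * C := by
    simpa using norm_sum_le_of_le Finset.univ (fun i _ => ha i)
  rw [norm_smul, Real.norm_of_nonneg (by positivity)]
  calc 1 / (n : ℝ) * ‖∑ i, a i‖ ≤ 1 / n * (n * C) := by gcongr
    _ = C := by field_simp

/-- Within an epoch, the search directions stay close to the reference direction `v`, provided
`γ L n ≤ 1 / 20`. -/
lemma svrg_epoch_direction_bound {n : ℕ} {L γ : ℝ} (hL : 0 < L) (hγ0 : 0 < γ)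
    (hγ : γ * L * n ≤ 1 / 20) (G : Fin n → E → E)
    (hlip : ∀ i x y, ‖G i x - G i y‖ ≤ L * ‖x - y‖) (p : Equiv.Perm (Fin n))
    (x u : ℕ → E) (ω v : E) (hx0 : x 0 = ω)
    (hu : ∀ t (ht : t < n), u t = G (p ⟨t, ht⟩) (x t) - G (p ⟨t, ht⟩) ω + v)
    (hx : ∀ t, t < n → x (t + 1) = x t - γ • u t) (t : ℕ) (ht : t < n) :
    ‖u t - v‖ ≤ ‖v‖ / 19 := by
  have hdir : ∀ t < n, ‖x t - ω‖ ≤ 20 / 19 * (γ * t * ‖v‖) → ‖u t - v‖ ≤ ‖v‖ / 19 := by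
    intro t ht h
    have htn : (t : ℝ) ≤ n := by exact_mod_cast ht.le
    calc ‖u t - v‖ = ‖G (p ⟨t, ht⟩) (x t) - G (p ⟨t, ht⟩) ω‖ := by rw [hu t ht]; simp
      _ ≤ L * ‖x t - ω‖ := hlip _ _ _
      _ ≤ L * (20 / 19 * (γ * n * ‖v‖)) := by
        gcongr
        exact h.trans (by gcongr)
      _ = 20 / 19 * (γ * L * n) * ‖v‖ := by ring
      _ ≤ 20 / 19 * (1 / 20) * ‖v‖ := by gcongr
      _ = ‖v‖ / 19 := by ring
  refine hdir t ht ?_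
  induction t with
  | zero => simp [hx0]
  | succ t ih =>
    have ht' : t < n := by omega
    have hut := hdir t ht' (ih ht')
    have hnorm : ‖u t‖ ≤ 20 / 19 * ‖v‖ := by
      have := norm_add_le (u t - v) v
      rw [sub_add_cancel] at this
      linarith
    calc ‖x (t + 1) - ω‖ = ‖(x t - ω) - γ • u t‖ := by rw [hx t ht']; congr 1; abel
      _ ≤ ‖x t - ω‖ + γ * ‖u t‖ := by
        simpa [norm_smul, abs_of_pos hγ0] using norm_sub_le (x t - ω) (γ • u t)
      _ ≤ 20 / 19 * (γ * t * ‖v‖) + γ * (20 / 19 * ‖v‖) := by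
        gcongr
        exact ih ht'
      _ = 20 / 19 * (γ * ((t + 1 : ℕ) : ℝ) * ‖v‖) := by push_cast; ring

/-- An epoch is one step of length `γ n` along a direction `w` which is close to the reference
direction `v`, and the next reference direction is close to the full gradient at the new point. -/
lemma svrg_epoch_step {n : ℕ} (hn : 0 < n) {L γ : ℝ} (hL : 0 < L) (hγ0 : 0 < γ)
    (hγ : γ * L * n ≤ 1 / 20) (G : Fin n → E → E)
    (hlip : ∀ i x y, ‖G i x - G i y‖ ≤ L * ‖x - y‖) (p : Equiv.Perm (Fin n))
    (x u : ℕ → E) (ω v : E) (hx0 : x 0 = ω)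
    (hu : ∀ t (ht : t < n), u t = G (p ⟨t, ht⟩) (x t) - G (p ⟨t, ht⟩) ω + v)
    (hx : ∀ t, t < n → x (t + 1) = x t - γ • u t) :
    ∃ w : E, x n = ω - (γ * n) • w ∧ ‖w - v‖ ≤ ‖w‖ / 18 ∧
      ‖(1 / (n : ℝ)) • ∑ t : Fin n, G (p t) (x t) - (1 / (n : ℝ)) • ∑ i, G i (x n)‖
        ≤ ‖w‖ / 18 := by
  have hn' : (n : ℝ) ≠ 0 := by exact_mod_cast hn.ne'
  have hdir := svrg_epoch_direction_bound hL hγ0 hγ G hlip p x u ω v hx0 hu hx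
  have hwv : ‖(1 / (n : ℝ)) • ∑ t : Fin n, u t - v‖ ≤ ‖v‖ / 19 := by
    have h := norm_average_le_s6 hn (fun t : Fin n => u t - v) (fun t => hdir t t.2)
    rwa [Finset.sum_sub_distrib, smul_sub, Finset.sum_const, Finset.card_univ, Fintype.card_fin,
      ← Nat.cast_smul_eq_nsmul ℝ, smul_smul, one_div_mul_cancel hn', one_smul] at h
  set w : E := (1 / (n : ℝ)) • ∑ t : Fin n, u t with hw
  have hvw : ‖v‖ / 19 ≤ ‖w‖ / 18 := by
    have := norm_sub_norm_le v w
    rw [norm_sub_rev] at this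
    linarith
  refine ⟨w, ?_, hwv.trans hvw, ?_⟩
  · have htel : x n - x 0 = ∑ t ∈ Finset.range n, -(γ • u t) := by
      rw [← Finset.sum_range_sub]
      refine Finset.sum_congr rfl fun t ht => ?_
      rw [hx t (Finset.mem_range.1 ht)]
      abel
    rw [Finset.sum_neg_distrib, ← Finset.smul_sum, hx0] at htel
    rw [hw, smul_smul, mul_assoc, mul_one_div_cancel hn', mul_one,
      Fin.sum_univ_eq_sum_range u n, sub_eq_add_neg, ← htel]
    abel
  · rw [← Equiv.sum_comp p (fun i => G i (x n)), ← smul_sub, ← Finset.sum_sub_distrib]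
    refine norm_average_le_s6 hn _ fun t => (hlip _ _ _).trans ?_
    have hdist : dist (x t) (x n) ≤ ∑ k ∈ Finset.Ico (t : ℕ) n, γ * (20 / 19 * ‖v‖) := by
      refine dist_le_Ico_sum_of_dist_le t.2.le fun {k} _ hk => ?_
      rw [hx k hk, dist_eq_norm, sub_sub_cancel, norm_smul, Real.norm_of_nonneg hγ0.le]
      gcongr
      have := norm_add_le (u k - v) v
      rw [sub_add_cancel] at this
      linarith [hdir k hk]
    rw [Finset.sum_const, Nat.card_Ico, nsmul_eq_mul, dist_eq_norm] at hdist
    have hcard : ((n - t : ℕ) : ℝ) ≤ n := by exact_mod_cast Nat.sub_le _ _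
    calc L * ‖x t - x n‖ ≤ L * (n * (γ * (20 / 19 * ‖v‖))) := by
          gcongr
          exact hdist.trans (by gcongr)
      _ = 20 / 19 * (γ * L * n) * ‖v‖ := by ring
      _ ≤ 20 / 19 * (1 / 20) * ‖v‖ := by gcongr
      _ = ‖v‖ / 19 := by ring
      _ ≤ ‖w‖ / 18 := hvw

/-- One inexact gradient step of length `h` contracts the Lyapunov function
`f - f(z) + 2 h ‖e‖²`, where `e` is the gradient error. -/
lemma inexact_gradient_step_contraction {L μ h : ℝ} (hμ0 : 0 < μ) (hμL : μ ≤ L)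
    (hh : 0 < h) (hhL : h * L ≤ 1 / 20) (f : E → ℝ) (g : E → E)
    (hlip : ∀ x y, ‖g x - g y‖ ≤ L * ‖x - y‖)
    (hsc : ∀ x y, f x + ⟪g x, y - x⟫ + μ / 2 * ‖y - x‖ ^ 2 ≤ f y)
    (z a b v w e : E) (hb : b = a - h • w) (hwv : ‖w - v‖ ≤ ‖w‖ / 18) (he : ‖e‖ ≤ ‖w‖ / 18) :
    f b - f z + 2 * h * ‖e‖ ^ 2
      ≤ (1 - h * μ / 2) * (f a - f z + 2 * h * ‖v - g a‖ ^ 2) := by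
  have hPL : 2 * μ * (f a - f z) ≤ ‖g a‖ ^ 2 := by
    have h1 := hsc a z
    have h2 : 0 ≤ ‖g a + μ • (z - a)‖ ^ 2 := by positivity
    rw [norm_add_sq_real, inner_smul_right, norm_smul, Real.norm_of_nonneg hμ0.le] at h2
    nlinarith [mul_le_mul_of_nonneg_left h1 hμ0.le]
  have hdescent : f b ≤ f a - h * ⟪g a, w⟫ + h * (1 / 20) * ‖w‖ ^ 2 := by
    have h1 := hsc b a
    have hab : a - b = h • w := by rw [hb]; abel
    have h2 : -(⟪g b - g a, h • w⟫) ≤ h * (1 / 20) * ‖w‖ ^ 2 := by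
      calc -(⟪g b - g a, h • w⟫) ≤ ‖g b - g a‖ * ‖h • w‖ :=
            (neg_le_abs _).trans (abs_real_inner_le_norm _ _)
        _ ≤ (L * ‖b - a‖) * ‖h • w‖ := by gcongr; exact hlip _ _
        _ = h * (h * L) * ‖w‖ ^ 2 := by
          rw [norm_sub_rev, hab, norm_smul, Real.norm_of_nonneg hh.le]; ring
        _ ≤ h * (1 / 20) * ‖w‖ ^ 2 := by gcongr
    rw [hab] at h1
    rw [inner_sub_left, inner_smul_right, inner_smul_right] at h2
    rw [inner_smul_right] at h1
    have h3 : 0 ≤ μ / 2 * ‖h • w‖ ^ 2 := by positivity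
    linarith
  have hpol : 2 * ⟪g a, w⟫ = ‖g a‖ ^ 2 + ‖w‖ ^ 2 - ‖w - g a‖ ^ 2 := by
    rw [norm_sub_sq_real, real_inner_comm]; ring
  have herr : ‖w - g a‖ ^ 2 ≤ 2 * ‖v - g a‖ ^ 2 + 2 * (‖w‖ / 18) ^ 2 := by
    have h1 : ‖w - g a‖ ≤ ‖v - g a‖ + ‖w‖ / 18 := by
      have := norm_add_le (w - v) (v - g a)
      rw [sub_add_sub_cancel] at this
      linarith
    have h2 : ‖w - g a‖ ^ 2 ≤ (‖v - g a‖ + ‖w‖ / 18) ^ 2 := by gcongr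
    nlinarith [sq_nonneg (‖v - g a‖ - ‖w‖ / 18)]
  have hesq : ‖e‖ ^ 2 ≤ (‖w‖ / 18) ^ 2 := by gcongr
  have hhμ : h * μ ≤ 1 / 20 := (mul_le_mul_of_nonneg_left hμL hh.le).trans hhL
  have hPL' : h * μ / 2 * (f a - f z) ≤ h * (‖g a‖ ^ 2 / 4) := by
    nlinarith [mul_le_mul_of_nonneg_left hPL hh.le]
  have herr' := mul_le_mul_of_nonneg_left herr hh.le
  have hesq' := mul_le_mul_of_nonneg_left hesq hh.le
  have hpol' : h * ⟪g a, w⟫ = h * (‖g a‖ ^ 2 + ‖w‖ ^ 2 - ‖w - g a‖ ^ 2) / 2 := by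
    rw [← hpol]; ring
  have hcoef : h * μ * (h * ‖v - g a‖ ^ 2) ≤ 1 / 20 * (h * ‖v - g a‖ ^ 2) := by gcongr
  have hw0 : 0 ≤ h * ‖w‖ ^ 2 := by positivity
  have hv0 : 0 ≤ h * ‖v - g a‖ ^ 2 := by positivity
  have hg0 : 0 ≤ h * ‖g a‖ ^ 2 := by positivity
  linarith

end NFGSVRG

/-- Theorem 2 (NFG-SVRG, strongly convex): if each `f_i` is `μ`-strongly convex
with `0 < μ ≤ L` and `n ≥ 2`, then NFG-SVRG with `0 < γ ≤ 1/(20 L n)` converges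
linearly: `f(ω_{S+1}) - f* ≤ (1 - γ μ n / 2)^S (f(ω_1) - f*)`. -/
theorem nfg_svrg_strongly_convex {n d : ℕ} (hn : 2 ≤ n) (hd : 1 ≤ d)
    (L μ : ℝ) (hL : 0 < L) (hμ0 : 0 < μ) (hμL : μ ≤ L)
    (F : Fin n → EuclideanSpace ℝ (Fin d) → ℝ)
    (hdiff : ∀ i, Differentiable ℝ (F i))
    (hlip : ∀ i x y, ‖gradient (F i) x - gradient (F i) y‖ ≤ L * ‖x - y‖)
    (hsc : ∀ i x y, F i y ≥
      F i x + ⟪gradient (F i) x, y - x⟫ + (μ / 2) * ‖y - x‖ ^ 2)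
    (f : EuclideanSpace ℝ (Fin d) → ℝ)
    (hf : ∀ z, f z = (1 / (n : ℝ)) * ∑ i, F i z)
    (fstar : ℝ) (hfstar : IsLeast (Set.range f) fstar)
    (γ : ℝ) (hγ0 : 0 < γ) (hγ : γ ≤ 1 / (20 * L * n))
    -- the NFG-SVRG algorithm
    (ω : ℕ → EuclideanSpace ℝ (Fin d)) (v : ℕ → EuclideanSpace ℝ (Fin d))
    (x : ℕ → ℕ → EuclideanSpace ℝ (Fin d)) (vt : ℕ → ℕ → EuclideanSpace ℝ (Fin d))
    (π : ℕ → Equiv.Perm (Fin n))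
    (hω0 : ω 0 = x 0 0) (hv0 : v 0 = 0)
    (hx0 : ∀ s, x s 0 = ω s)
    (hvt : ∀ s t (ht : t < n),
      vt s t = gradient (F (π s ⟨t, ht⟩)) (x s t)
        - gradient (F (π s ⟨t, ht⟩)) (ω s) + v s)
    (hxt : ∀ s t, t < n → x s (t + 1) = x s t - γ • vt s t)
    (hωs : ∀ s, ω (s + 1) = x s n)
    (hxs : ∀ s, x (s + 1) 0 = x s n)
    (hvs : ∀ s, v (s + 1) = (1 / (n : ℝ)) • ∑ t : Fin n, gradient (F (π s t)) (x s t))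
    (S : ℕ) (hS : 1 ≤ S) :
    f (ω (S + 1)) - fstar ≤ (1 - γ * μ * n / 2) ^ S * (f (ω 1) - fstar) := by
  have hn0 : 0 < n := by omega
  have hn' : (0 : ℝ) < n := by exact_mod_cast hn0
  have hstep : γ * L * n ≤ 1 / 20 := by
    calc γ * L * n ≤ 1 / (20 * L * n) * L * n := by gcongr
      _ = 1 / 20 := by field_simp
  set g : EuclideanSpace ℝ (Fin d) → EuclideanSpace ℝ (Fin d) :=
    fun z => (1 / (n : ℝ)) • ∑ i, gradient (F i) z with hg
  have hglip : ∀ y z, ‖g y - g z‖ ≤ L * ‖y - z‖ := by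
    intro y z
    simp only [hg]
    rw [← smul_sub, ← Finset.sum_sub_distrib]
    exact norm_average_le_s6 hn0 _ fun i => hlip i y z
  have hfsc : ∀ y z, f y + ⟪g y, z - y⟫ + μ / 2 * ‖z - y‖ ^ 2 ≤ f z := by
    intro y z
    have hsum := Finset.sum_le_sum fun i (_ : i ∈ Finset.univ) => hsc i y z
    rw [Finset.sum_add_distrib, Finset.sum_add_distrib, ← sum_inner, Finset.sum_const,
      Finset.card_univ, Fintype.card_fin, nsmul_eq_mul] at hsum
    have hmul := mul_le_mul_of_nonneg_left hsum (one_div_nonneg.2 hn'.le)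
    rw [mul_add, mul_add, ← mul_assoc, one_div_mul_cancel hn'.ne', one_mul] at hmul
    rw [hf y, hf z]
    simp only [hg]
    rw [real_inner_smul_left]
    exact hmul
  obtain ⟨z, hz⟩ := hfstar.1
  have hepoch : ∀ s, ∃ w, ω (s + 1) = ω s - (γ * n) • w ∧ ‖w - v s‖ ≤ ‖w‖ / 18 ∧
      ‖v (s + 1) - g (ω (s + 1))‖ ≤ ‖w‖ / 18 := by
    intro s
    rw [hωs s, hvs s]
    exact svrg_epoch_step hn0 hL hγ0 hstep (fun i => gradient (F i)) hlip (π s) (x s) (vt s)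
      (ω s) (v s) (hx0 s) (hvt s) (hxt s)
  have hv1 : v 1 - g (ω 1) = 0 := by
    obtain ⟨w, -, hw, he⟩ := hepoch 0
    rw [hv0, sub_zero] at hw
    have hw0 : ‖w‖ = 0 := le_antisymm (by linarith) (norm_nonneg w)
    rw [hw0, zero_div] at he
    exact norm_le_zero_iff.1 he
  have hcontr : ∀ s, f (ω (s + 1)) - f z + 2 * (γ * n) * ‖v (s + 1) - g (ω (s + 1))‖ ^ 2
      ≤ (1 - γ * μ * n / 2) * (f (ω s) - f z + 2 * (γ * n) * ‖v s - g (ω s)‖ ^ 2) := by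
    intro s
    obtain ⟨w, hω, hw, he⟩ := hepoch s
    have h := inexact_gradient_step_contraction hμ0 hμL (h := γ * n) (by positivity)
      (by linarith) f g hglip hfsc z (ω s) (ω (s + 1)) (v s) w _ hω hw he
    rwa [mul_right_comm γ (n : ℝ) μ] at h
  have hrate : 0 ≤ 1 - γ * μ * n / 2 := by
    have : γ * μ * n ≤ γ * L * n := by gcongr
    linarith
  have hlyap : ∀ k, f (ω (k + 1)) - f z + 2 * (γ * n) * ‖v (k + 1) - g (ω (k + 1))‖ ^ 2
      ≤ (1 - γ * μ * n / 2) ^ k * (f (ω 1) - f z) := by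
    intro k
    induction k with
    | zero => simp [hv1]
    | succ k ih =>
      rw [pow_succ' (1 - γ * μ * n / 2), mul_assoc (1 - γ * μ * n / 2)]
      exact (hcontr (k + 1)).trans (mul_le_mul_of_nonneg_left ih hrate)
  rw [← hz]
  refine le_trans ?_ (hlyap S)
  exact le_add_of_nonneg_right (by positivity)
end

section
/- Consider two consecutive NFG-SARAH epochs with stepsize γ satisfying 0 < γ ≤ 1/(3L): an earlier epoch with starting point x'^0 ∈ ℝ^d, arbitrary gradient estimate v' ∈ ℝ^d and permutation π' producing iterates x'^0, x'^1, …, x'^{n+1}, followed by the current epoch with starting point x^0 = x'^{n+1}, gradient estimate v = (1/n)∑_{t=1}^{n} ∇f_{π'(t)}(x'^t) and permutation π producing iterates x^0, …, x^{n+1} and estimators v^0, …, v^n. Then ‖∇f(x^0) − (1/(n+1))∑_{t=0}^{n} v^t‖² ≤ 9γ²L²‖v‖² + 36γ²L²n²‖v'‖². -/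
/-- If each increment of a sequence is at most `b` times the current norm and `n * b ≤ 1 / 3`,
then during the first `n` steps the sequence drifts from its start at most linearly. -/
theorem norm_sub_zero_le_of_norm_increment_le {E : Type*} [NormedAddCommGroup E] {n : ℕ} {b : ℝ}
    (hb : 0 ≤ b) (hnb : n * b ≤ 1 / 3) (u : ℕ → E)
    (hu : ∀ t, t < n → ‖u (t + 1) - u t‖ ≤ b * ‖u t‖) (t : ℕ) (ht : t ≤ n) :
    ‖u t - u 0‖ ≤ 3 / 2 * (t * b) * ‖u 0‖ ∧ ‖u t‖ ≤ 3 / 2 * ‖u 0‖ := by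
  induction t with
  | zero =>
    simp only [sub_self, norm_zero, Nat.cast_zero]
    constructor <;> nlinarith [norm_nonneg (u 0)]
  | succ t ih =>
    obtain ⟨ih₁, ih₂⟩ := ih (by omega)
    have hstep : ‖u (t + 1) - u 0‖ ≤ ‖u (t + 1) - u t‖ + ‖u t - u 0‖ :=
      norm_sub_le_norm_sub_add_norm_sub _ _ _
    have hinc := (hu t (by omega)).trans (mul_le_mul_of_nonneg_left ih₂ hb)
    have hdrift : ‖u (t + 1) - u 0‖ ≤ 3 / 2 * ((t + 1 : ℕ) * b) * ‖u 0‖ := by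
      push_cast
      linarith
    have htb : ((t + 1 : ℕ) : ℝ) * b ≤ 1 / 3 :=
      (mul_le_mul_of_nonneg_right (by exact_mod_cast ht) hb).trans hnb
    have htri : ‖u (t + 1)‖ ≤ ‖u (t + 1) - u 0‖ + ‖u 0‖ := by
      simpa using norm_add_le (u (t + 1) - u 0) (u 0)
    refine ⟨hdrift, ?_⟩
    linarith [mul_le_mul_of_nonneg_right htb (norm_nonneg (u 0))]

/-- One step of the recursive estimator changes it by at most a factor `γ * L / n` of its norm. -/
theorem norm_recursive_estimator_increment_le {E : Type*} [NormedAddCommGroup E]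
    [NormedSpace ℝ E] {n : ℕ} {L γ : ℝ} (hγ : 0 ≤ γ) {g : E → E}
    (hg : ∀ x y, ‖g x - g y‖ ≤ L * ‖x - y‖) {x y u w : E}
    (hy : y = x - γ • u) (hw : w = u + (1 / (n : ℝ)) • (g y - g x)) :
    ‖w - u‖ ≤ γ * L / n * ‖u‖ := by
  have hyx : ‖y - x‖ = γ * ‖u‖ := by
    rw [hy, sub_sub_cancel_left, norm_neg, norm_smul, Real.norm_of_nonneg hγ]
  rw [hw, add_sub_cancel_left, norm_smul, Real.norm_of_nonneg (by positivity)]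
  calc 1 / (n : ℝ) * ‖g y - g x‖ ≤ 1 / (n : ℝ) * (L * (γ * ‖u‖)) := by
        rw [← hyx]
        gcongr
        exact hg y x
    _ = γ * L / n * ‖u‖ := by ring

/-- A sequence with steps of norm at most `c` moves at most `(m - t) * c` between times
`t` and `m`. -/
theorem norm_sub_le_mul_of_norm_step_le {E : Type*} [NormedAddCommGroup E] {c : ℝ} {m : ℕ}
    (x : ℕ → E) (hx : ∀ t, t < m → ‖x (t + 1) - x t‖ ≤ c) (t : ℕ) (ht : t ≤ m) :
    ‖x m - x t‖ ≤ ((m : ℝ) - t) * c := by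
  induction m, ht using Nat.le_induction with
  | base => simp
  | succ k hk ih =>
    have hstep := norm_sub_le_norm_sub_add_norm_sub (x (k + 1)) (x k) (x t)
    have hlast := hx k (by omega)
    have hprev := ih fun s hs => hx s (by omega)
    push_cast
    linarith

/-- The gradient of a scaled finite sum is the scaled sum of the gradients. -/
theorem gradient_const_mul_sum {ι E : Type*} [Fintype ι] [NormedAddCommGroup E]
    [InnerProductSpace ℝ E] [CompleteSpace E] (c : ℝ) (F : ι → E → ℝ)
    (hF : ∀ i, Differentiable ℝ (F i)) (z : E) :
    gradient (fun y => c * ∑ i, F i y) z = c • ∑ i, gradient (F i) z := by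
  apply HasGradientAt.gradient
  rw [hasGradientAt_iff_hasFDerivAt, map_smul, map_sum]
  exact (HasFDerivAt.fun_sum fun i _ =>
    ((hF i z).hasGradientAt).hasFDerivAt).const_mul c

/-- The average of `m` vectors is within `c` of any point that is within `c` of each of them. -/
theorem norm_sub_average_le {E : Type*} [NormedAddCommGroup E] [NormedSpace ℝ E] {m : ℕ}
    (hm : m ≠ 0) {c : ℝ} (u : ℕ → E) (a : E) (h : ∀ t ∈ Finset.range m, ‖a - u t‖ ≤ c) :
    ‖a - (1 / (m : ℝ)) • ∑ t ∈ Finset.range m, u t‖ ≤ c := by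
  have hm' : (m : ℝ) ≠ 0 := Nat.cast_ne_zero.mpr hm
  have havg : a - (1 / (m : ℝ)) • ∑ t ∈ Finset.range m, u t
      = (1 / (m : ℝ)) • ∑ t ∈ Finset.range m, (a - u t) := by
    rw [Finset.sum_sub_distrib, Finset.sum_const, Finset.card_range, smul_sub,
      ← Nat.cast_smul_eq_nsmul ℝ, smul_smul, one_div_mul_cancel hm', one_smul]
  rw [havg, norm_smul, Real.norm_of_nonneg (by positivity)]
  calc 1 / (m : ℝ) * ‖∑ t ∈ Finset.range m, (a - u t)‖ ≤ 1 / (m : ℝ) * (m * c) := by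
        gcongr
        simpa using norm_sum_le_of_le _ h
    _ = c := by field_simp


/-- Lemma 6 (NFG-SARAH): for two consecutive NFG-SARAH epochs with stepsize
`0 < γ ≤ 1/(3L)`, the discrepancy between the true gradient at the current
starting point and the average of the current epoch's estimators is bounded by
`9 γ² L² ‖v‖² + 36 γ² L² n² ‖v'‖²`. -/
theorem nfg_sarah_two_epoch_bound {n d : ℕ} (hn : 1 ≤ n) (hd : 1 ≤ d)
    (L : ℝ) (hL : 0 < L)
    (F : Fin n → EuclideanSpace ℝ (Fin d) → ℝ)
    (hdiff : ∀ i, Differentiable ℝ (F i))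
    (hlip : ∀ i x y, ‖gradient (F i) x - gradient (F i) y‖ ≤ L * ‖x - y‖)
    (f : EuclideanSpace ℝ (Fin d) → ℝ)
    (hf : ∀ z, f z = (1 / (n : ℝ)) * ∑ i, F i z)
    (γ : ℝ) (hγ0 : 0 < γ) (hγ : γ ≤ 1 / (3 * L))
    -- earlier epoch
    (v' : EuclideanSpace ℝ (Fin d)) (π' : Equiv.Perm (Fin n))
    (x' : ℕ → EuclideanSpace ℝ (Fin d)) (vt' : ℕ → EuclideanSpace ℝ (Fin d))
    (hvt'0 : vt' 0 = v')
    (hvt' : ∀ t (ht : t < n),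
      vt' (t + 1) = vt' t + (1 / (n : ℝ)) •
        (gradient (F (π' ⟨t, ht⟩)) (x' (t + 1)) - gradient (F (π' ⟨t, ht⟩)) (x' t)))
    (hx't : ∀ t, t ≤ n → x' (t + 1) = x' t - γ • vt' t)
    -- current epoch
    (v : EuclideanSpace ℝ (Fin d)) (π : Equiv.Perm (Fin n))
    (x : ℕ → EuclideanSpace ℝ (Fin d)) (vt : ℕ → EuclideanSpace ℝ (Fin d))
    (hx0 : x 0 = x' (n + 1))
    (hv : v = (1 / (n : ℝ)) • ∑ t : Fin n, gradient (F (π' t)) (x' (t + 1)))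
    (hvt0 : vt 0 = v)
    (hvt : ∀ t (ht : t < n),
      vt (t + 1) = vt t + (1 / (n : ℝ)) •
        (gradient (F (π ⟨t, ht⟩)) (x (t + 1)) - gradient (F (π ⟨t, ht⟩)) (x t)))
    (hxt : ∀ t, t ≤ n → x (t + 1) = x t - γ • vt t) :
    ‖gradient f (x 0) - (1 / ((n : ℝ) + 1)) • ∑ t ∈ Finset.range (n + 1), vt t‖ ^ 2 ≤
      9 * γ ^ 2 * L ^ 2 * ‖v‖ ^ 2
        + 36 * γ ^ 2 * L ^ 2 * (n : ℝ) ^ 2 * ‖v'‖ ^ 2 := by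
  have hn0 : (0 : ℝ) < n := by exact_mod_cast hn
  have hstep : γ * L ≤ 1 / 3 := by
    rw [le_div_iff₀ (by positivity)] at hγ
    linarith
  have hb : 0 ≤ γ * L / n := by positivity
  have hnb : (n : ℝ) * (γ * L / n) = γ * L := by field_simp
  have hcur := norm_sub_zero_le_of_norm_increment_le hb (hnb.trans_le hstep) vt fun t ht =>
    norm_recursive_estimator_increment_le hγ0.le (hlip _) (hxt t ht.le) (hvt t ht)
  have hprev := norm_sub_zero_le_of_norm_increment_le hb (hnb.trans_le hstep) vt' fun t ht =>
    norm_recursive_estimator_increment_le hγ0.le (hlip _) (hx't t ht.le) (hvt' t ht)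
  rw [hvt0] at hcur
  rw [hvt'0] at hprev
  have havg : ‖v - (1 / ((n : ℝ) + 1)) • ∑ t ∈ Finset.range (n + 1), vt t‖
      ≤ 3 / 2 * (γ * L) * ‖v‖ := by
    have h := norm_sub_average_le (c := 3 / 2 * (γ * L) * ‖v‖) n.succ_ne_zero vt v fun t ht => by
      have htn : t ≤ n := Nat.lt_succ_iff.mp (Finset.mem_range.mp ht)
      rw [norm_sub_rev]
      calc ‖vt t - v‖ ≤ 3 / 2 * (t * (γ * L / n)) * ‖v‖ := (hcur t htn).1
        _ ≤ 3 / 2 * (n * (γ * L / n)) * ‖v‖ := by gcongr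
        _ = 3 / 2 * (γ * L) * ‖v‖ := by rw [hnb]
    simpa using h
  have hmove : ∀ t : Fin n, ‖x' (n + 1) - x' (t + 1)‖ ≤ n * (γ * (3 / 2 * ‖v'‖)) := by
    intro t
    refine (norm_sub_le_mul_of_norm_step_le (c := γ * (3 / 2 * ‖v'‖)) x' (fun s hs => ?_)
      (t + 1) (by omega)).trans ?_
    · rw [hx't s (by omega), sub_sub_cancel_left, norm_neg, norm_smul, Real.norm_of_nonneg hγ0.le]
      gcongr
      exact (hprev s (by omega)).2
    · gcongr
      push_cast
      linarith [(Nat.cast_nonneg (t : ℕ) : (0 : ℝ) ≤ (t : ℕ))]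
  have hgrad : ‖gradient f (x 0) - v‖ ≤ 3 / 2 * (γ * L) * (n * ‖v'‖) := by
    rw [funext hf, gradient_const_mul_sum _ F hdiff, hv, hx0,
      ← Equiv.sum_comp π' fun i => gradient (F i) (x' (n + 1)), ← smul_sub,
      ← Finset.sum_sub_distrib, norm_smul, Real.norm_of_nonneg (by positivity)]
    calc _ ≤ 1 / (n : ℝ) * (n * (L * (n * (γ * (3 / 2 * ‖v'‖))))) := by
          gcongr
          have h := norm_sum_le_of_le (Finset.univ : Finset (Fin n)) fun t _ =>
            (hlip (π' t) (x' (n + 1)) (x' (t + 1))).trans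
              (mul_le_mul_of_nonneg_left (hmove t) hL.le)
          simpa using h
      _ = 3 / 2 * (γ * L) * (n * ‖v'‖) := by field_simp
  have htotal := (norm_sub_le_norm_sub_add_norm_sub _ _ _).trans (add_le_add hgrad havg)
  refine (pow_le_pow_left₀ (norm_nonneg _) htotal 2).trans ?_
  nlinarith [mul_nonneg (sq_nonneg (γ * L)) (sq_nonneg (‖v‖ - n * ‖v'‖)),
    sq_nonneg (γ * L * ‖v‖), sq_nonneg (γ * L * (n * ‖v'‖))]
end

section
/- Let f : ℝ^d → ℝ be differentiable with L-Lipschitz gradient for some L > 0, let n ≥ 1 be an integer, and let γ satisfy 0 < γ ≤ 1/(L(n+1)). Then for any point x ∈ ℝ^d and any vectors u_0, …, u_n ∈ ℝ^d, the point y = x − γ ∑_{t=0}^{n} u_t satisfies f(y) ≤ f(x) − (γ(n+1)/2)‖∇f(x)‖² + (γ(n+1)/2)‖∇f(x) − (1/(n+1))∑_{t=0}^{n} u_t‖². -/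
/-- Quadratic upper bound for a differentiable function with `L`-Lipschitz gradient. -/
theorem le_add_inner_gradient_add_sq_of_gradient_lipschitz {E : Type*} [NormedAddCommGroup E]
    [InnerProductSpace ℝ E] [CompleteSpace E] {f : E → ℝ} {L : ℝ} (hdiff : Differentiable ℝ f)
    (hlip : ∀ x y, ‖gradient f x - gradient f y‖ ≤ L * ‖x - y‖) (x v : E) :
    f (x + v) ≤ f x + inner ℝ (gradient f x) v + L / 2 * ‖v‖ ^ 2 := by
  have hline (t : ℝ) : HasDerivAt (fun s : ℝ => x + s • v) v t := by
    simpa using ((hasDerivAt_id t).smul_const v).const_add x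
  have hf (t : ℝ) : HasDerivAt (fun s : ℝ => f (x + s • v))
      (inner ℝ (gradient f (x + t • v)) v) t := by
    simpa [Function.comp_def] using (hdiff (x + t • v)).hasFDerivAt.comp_hasDerivAt t (hline t)
  have hB (t : ℝ) : HasDerivAt
      (fun s : ℝ => f x + s * inner ℝ (gradient f x) v + L / 2 * ‖v‖ ^ 2 * s ^ 2)
      (inner ℝ (gradient f x) v + L * ‖v‖ ^ 2 * t) t := by
    refine ((((hasDerivAt_id t).mul_const (inner ℝ (gradient f x) v)).const_add (f x)).add
      ((hasDerivAt_pow 2 t).const_mul (L / 2 * ‖v‖ ^ 2))).congr_deriv ?_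
    norm_num
    ring
  have key := image_le_of_deriv_right_le_deriv_boundary (a := 0) (b := 1)
    (fun t _ => (hf t).continuousAt.continuousWithinAt)
    (fun t _ => (hf t).hasDerivWithinAt) (by simp)
    (fun t _ => (hB t).continuousAt.continuousWithinAt)
    (fun t _ => (hB t).hasDerivWithinAt)
    (fun t ht => by
      have h : inner ℝ (gradient f (x + t • v) - gradient f x) v ≤ L * ‖v‖ ^ 2 * t :=
        calc inner ℝ (gradient f (x + t • v) - gradient f x) v
            ≤ ‖gradient f (x + t • v) - gradient f x‖ * ‖v‖ := real_inner_le_norm _ _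
          _ ≤ L * ‖x + t • v - x‖ * ‖v‖ := by gcongr; exact hlip _ _
          _ = L * ‖v‖ ^ 2 * t := by
            rw [add_sub_cancel_left, norm_smul, Real.norm_of_nonneg ht.1]
            ring
      rw [inner_sub_left] at h
      linarith)
    (Set.right_mem_Icc.2 zero_le_one)
  simpa using key

/-- Descent lemma for one NFG-SARAH epoch step (an epoch consists of `n+1`
update steps): for an `L`-smooth function `f`, an aggregate step
`y = x - γ ∑_{t=0}^n u_t` with `0 < γ ≤ 1/(L(n+1))` satisfies the one-epoch
descent inequality. -/
theorem nfg_sarah_descent_lemma {d : ℕ} (hd : 1 ≤ d)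
    (f : EuclideanSpace ℝ (Fin d) → ℝ) (L : ℝ) (hL : 0 < L)
    (hdiff : Differentiable ℝ f)
    (hlip : ∀ x y, ‖gradient f x - gradient f y‖ ≤ L * ‖x - y‖)
    (n : ℕ) (hn : 1 ≤ n) (γ : ℝ) (hγ0 : 0 < γ) (hγ : γ ≤ 1 / (L * ((n : ℝ) + 1)))
    (x : EuclideanSpace ℝ (Fin d)) (u : Fin (n + 1) → EuclideanSpace ℝ (Fin d)) :
    f (x - γ • ∑ t, u t) ≤
      f x - (γ * ((n : ℝ) + 1) / 2) * ‖gradient f x‖ ^ 2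
        + (γ * ((n : ℝ) + 1) / 2) * ‖gradient f x - (1 / ((n : ℝ) + 1)) • ∑ t, u t‖ ^ 2 := by
  have hN : (0 : ℝ) < (n : ℝ) + 1 := by positivity
  set S := ∑ t, u t
  have hstep := le_add_inner_gradient_add_sq_of_gradient_lipschitz hdiff hlip x (-(γ • S))
  rw [← sub_eq_add_neg, inner_neg_right, real_inner_smul_right, norm_neg, norm_smul,
    Real.norm_of_nonneg hγ0.le] at hstep
  rw [norm_sub_sq_real, real_inner_smul_right, norm_smul, Real.norm_of_nonneg (by positivity)]
  have hLγ : L * γ ≤ 1 / ((n : ℝ) + 1) := by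
    rw [le_div_iff₀ (by positivity)] at hγ ⊢
    linarith
  have hquad : L / 2 * (γ * ‖S‖) ^ 2 ≤ γ / 2 * (1 / ((n : ℝ) + 1)) * ‖S‖ ^ 2 :=
    calc L / 2 * (γ * ‖S‖) ^ 2 = γ / 2 * (L * γ) * ‖S‖ ^ 2 := by ring
      _ ≤ γ / 2 * (1 / ((n : ℝ) + 1)) * ‖S‖ ^ 2 := by gcongr
  refine (hstep.trans (add_le_add_right hquad _)).trans_eq ?_
  field_simp
  ring
end
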